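/- Let a(n) denote the number of permutations of length n (with a(0) = 1 for the empty permutation) that avoid all four of the patterns 4132, 4231, 31254, and 41253. Then there exist formal power series c(z), d(z), b(z), m(z) in ℚ[[z]] satisfying the system c = 1 + z·c², (1−z)·d = (1−z) + z·d², (1−z)·b = (1−z)·z·c·b + z², and (1−z)·m = z²·(d−1) + (1−z)·z·c·b·(d−1) + (1−z)·z·c·m·d, such that the generating function F(z) = Σ_{n≥0} a(n) z^n satisfies F = c + c·m·d. -/

import Mathlib

/-- `σ` contains an occurrence of the pattern `π` using only positions in `S`. -/
def ContainsIn {n m : ℕ} (σ : Equiv.Perm (Fin n)) (π : Equiv.Perm (Fin m))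
    (S : Set (Fin n)) : Prop :=
  ∃ f : Fin m → Fin n, StrictMono f ∧ (∀ s, f s ∈ S) ∧
    ∀ s t : Fin m, σ (f s) < σ (f t) ↔ π s < π t

/-- `σ` contains an occurrence of the pattern `π`. -/
def Contains {n m : ℕ} (σ : Equiv.Perm (Fin n)) (π : Equiv.Perm (Fin m)) : Prop :=
  ContainsIn σ π Set.univ

/-- `σ` avoids the pattern `π`. -/
def Avoids {n m : ℕ} (σ : Equiv.Perm (Fin n)) (π : Equiv.Perm (Fin m)) : Prop :=
  ¬ Contains σ π

/-- `σ` lies in the juxtaposition class `Av(P|Q)`: positions split at some cut `k`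
(`0 ≤ k ≤ n`), no occurrence of `P` within the first `k` positions and no occurrence
of `Q` within the remaining positions. -/
def JuxtAv {n p q : ℕ} (P : Equiv.Perm (Fin p)) (Q : Equiv.Perm (Fin q))
    (σ : Equiv.Perm (Fin n)) : Prop :=
  ∃ k ≤ n, ¬ ContainsIn σ P {i : Fin n | (i : ℕ) < k} ∧
    ¬ ContainsIn σ Q {i : Fin n | k ≤ (i : ℕ)}

noncomputable def p4132 : Equiv.Perm (Fin 4) :=
  Equiv.ofBijective (![3,0,2,1] : Fin 4 → Fin 4) (by decide)

noncomputable def p4231 : Equiv.Perm (Fin 4) :=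
  Equiv.ofBijective (![3,1,2,0] : Fin 4 → Fin 4) (by decide)

noncomputable def p31254 : Equiv.Perm (Fin 5) :=
  Equiv.ofBijective (![2,0,1,4,3] : Fin 5 → Fin 5) (by decide)

noncomputable def p41253 : Equiv.Perm (Fin 5) :=
  Equiv.ofBijective (![3,0,1,4,2] : Fin 5 → Fin 5) (by decide)

noncomputable def F : PowerSeries ℚ :=
  PowerSeries.mk fun n => (Nat.card {σ : Equiv.Perm (Fin n) // Avoids σ p4132 ∧ Avoids σ p4231 ∧ Avoids σ p31254 ∧ Avoids σ p41253} : ℚ)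


def A3 (l : List ℕ) : Prop := ∀ a b c, [a, b, c].Sublist l → ¬ (b < c ∧ c < a)

def PL (s : Finset ℕ) : Finset (List ℕ) := s.val.lists.toFinset

lemma mem_PL {s : Finset ℕ} {l : List ℕ} : l ∈ PL s ↔ l.Nodup ∧ ∀ x, x ∈ l ↔ x ∈ s := by
  unfold PL
  rw [Multiset.mem_toFinset, Multiset.mem_lists_iff]
  constructor
  · intro h
    have h1 := s.nodup
    rw [h] at h1
    refine ⟨by simpa using h1, fun x => ?_⟩
    rw [← Finset.mem_val, h]; simp
  · rintro ⟨h1, h2⟩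
    refine (Multiset.Nodup.ext s.nodup (t := (l : Multiset ℕ)) (by simpa using h1)).2 ?_
    intro x; simp [h2]

open scoped Classical in
noncomputable def AL (s : Finset ℕ) : Finset (List ℕ) := (PL s).filter A3

lemma mem_AL {s : Finset ℕ} {l : List ℕ} :
    l ∈ AL s ↔ (l.Nodup ∧ ∀ x, x ∈ l ↔ x ∈ s) ∧ A3 l := by
  classical
  unfold AL; rw [Finset.mem_filter, mem_PL]

lemma A3_of_sublist {l l' : List ℕ} (h : l.Sublist l') (h' : A3 l') : A3 l :=
  fun a b c hs => h' a b c (hs.trans h)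

lemma pair_sub_append {a b : ℕ} {l r : List ℕ} :
    [a, b].Sublist (l ++ r) ↔ [a,b].Sublist l ∨ (a ∈ l ∧ b ∈ r) ∨ [a,b].Sublist r := by
  rw [List.sublist_append_iff]
  constructor
  · rintro ⟨l1, l2, h, h1, h2⟩
    simp only [List.cons_eq_append_iff, List.nil_eq_append_iff] at h
    rcases h with ⟨rfl, rfl⟩ | ⟨x, rfl, ⟨rfl, rfl⟩ | ⟨y, rfl, rfl, rfl⟩⟩
    · simp_all
    · simp_all
    · simp_all
  · rintro (h | ⟨h1, h2⟩ | h)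
    · exact ⟨[a,b], [], by simp, h, by simp⟩
    · exact ⟨[a], [b], by simp, by simpa, by simpa⟩
    · exact ⟨[], [a,b], by simp, by simp, h⟩

lemma triple_sub_append {a b c : ℕ} {l r : List ℕ} :
    [a, b, c].Sublist (l ++ r) ↔ [a,b,c].Sublist l ∨ ([a,b].Sublist l ∧ c ∈ r) ∨
      (a ∈ l ∧ [b,c].Sublist r) ∨ [a,b,c].Sublist r := by
  rw [List.sublist_append_iff]
  constructor
  · rintro ⟨l1, l2, h, h1, h2⟩
    simp only [List.cons_eq_append_iff, List.nil_eq_append_iff] at h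
    rcases h with ⟨rfl, rfl⟩ | ⟨x, rfl, ⟨rfl, rfl⟩ | ⟨y, rfl, ⟨rfl, rfl⟩ | ⟨z, rfl, rfl, rfl⟩⟩⟩
    · simp_all
    · simp_all
    · simp_all
    · simp_all
  · rintro (h | ⟨h1, h2⟩ | ⟨h1, h2⟩ | h)
    · exact ⟨[a,b,c], [], by simp, h, by simp⟩
    · exact ⟨[a,b], [c], by simp, by simpa, by simpa⟩
    · exact ⟨[a], [b,c], by simp, by simpa, by simpa⟩
    · exact ⟨[], [a,b,c], by simp, by simp, h⟩

lemma A3_snoc {l : List ℕ} {t : ℕ} :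
    A3 (l ++ [t]) ↔ A3 l ∧ ∀ a b, [a,b].Sublist l → ¬ (b < t ∧ t < a) := by
  unfold A3
  simp only [triple_sub_append]
  constructor
  · intro h
    exact ⟨fun a b c hs => h a b c (Or.inl hs), fun a b hs => h a b t (by simp [hs])⟩
  · rintro ⟨h1, h2⟩ a b c (h | ⟨h, h'⟩ | ⟨h, h'⟩ | h)
    · exact h1 _ _ _ h
    · simp at h'; subst h'; exact h2 _ _ h
    · have := h'.length_le; simp at this
    · have := h.length_le; simp at this

lemma split_of_A3 {t : ℕ} : ∀ {l : List ℕ}, t ∉ l →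
    (∀ a b, [a,b].Sublist l → ¬ (b < t ∧ t < a)) →
    l = l.filter (· < t) ++ l.filter (t < ·)
  | [], _, _ => by simp
  | x :: l, ht, h => by
    have ih := split_of_A3 (t := t) (l := l) (by simp_all) (fun a b hs => h a b (hs.cons x))
    simp only [List.mem_cons, not_or] at ht
    rcases lt_or_gt_of_ne ht.1 with hx | hx
    · have e : l.filter (· < t) = [] := by
        rw [List.filter_eq_nil_iff]
        intro y hy hyt
        exact h x y (by simpa using hy) ⟨by simpa using hyt, hx⟩
      rw [e] at ih
      rw [List.filter_cons_of_neg (by simp; omega), List.filter_cons_of_pos (by simpa using hx), e]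
      simpa using ih
    · rw [List.filter_cons_of_pos (by simpa using hx), List.filter_cons_of_neg (by simp; omega)]
      simpa using ih

lemma A3_append_append {L U : List ℕ} {t : ℕ} (hL : ∀ x ∈ L, x < t) (hU : ∀ x ∈ U, t < x)
    (h1 : A3 L) (h2 : A3 U) : A3 (L ++ U ++ [t]) := by
  rw [A3_snoc]
  constructor
  · intro a b c h
    rw [triple_sub_append] at h
    rcases h with h | ⟨h, h'⟩ | ⟨h, h'⟩ | h
    · exact h1 _ _ _ h
    · have := hL a (h.subset (by simp)); have := hU c h'; omega
    · have := hL a h; have := hU b (h'.subset (by simp)); omega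
    · exact h2 _ _ _ h
  · intro a b h
    rw [pair_sub_append] at h
    rcases h with h | ⟨h, h'⟩ | h
    · have := hL a (h.subset (by simp)); omega
    · have := hL a h; omega
    · have := hU b (h.subset (by simp)); omega

open scoped Classical in
lemma card_W (s : Finset ℕ) (t : ℕ) (ht : t ∉ s) :
    ((AL s).filter (fun p => A3 (p ++ [t]))).card
      = (AL (s.filter (· < t))).card * (AL (s.filter (t < ·))).card := by
  rw [← Finset.card_product]
  symm
  apply Finset.card_bij (fun p _ => p.1 ++ p.2)
  · rintro ⟨L, U⟩ h
    simp only [Finset.mem_product, mem_AL, Finset.mem_filter] at h ⊢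
    obtain ⟨⟨⟨a1, a2⟩, a3⟩, ⟨b1, b2⟩, b3⟩ := h
    have key := A3_append_append (fun x hx => ((a2 x).1 hx).2) (fun x hx => ((b2 x).1 hx).2) a3 b3
    refine ⟨⟨⟨?_, ?_⟩, ?_⟩, key⟩
    · rw [List.nodup_append]
      refine ⟨a1, b1, ?_⟩
      intro x hx y hy
      have := ((a2 x).1 hx).2; have := ((b2 y).1 hy).2; omega
    · intro x
      rw [List.mem_append, a2, b2]
      have : x = t → x ∉ s := by rintro rfl; exact ht
      rcases lt_trichotomy x t with h | h | h
      · simp [h]; omega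
      · simp [this h]
      · simp only [h, and_true]; constructor
        · rintro (h | h)
          · exact h.1
          · exact h
        · exact Or.inr
    · exact A3_of_sublist (List.sublist_append_left _ _) key
  · rintro ⟨L, U⟩ h ⟨L', U'⟩ h' e
    simp only [Finset.mem_product, mem_AL, Finset.mem_filter] at h h' e
    obtain ⟨⟨⟨a1, a2⟩, a3⟩, ⟨b1, b2⟩, b3⟩ := h
    obtain ⟨⟨⟨a1', a2'⟩, a3'⟩, ⟨b1', b2'⟩, b3'⟩ := h'
    have hl : L.length = L'.length := by
      rw [← List.toFinset_card_of_nodup a1, ← List.toFinset_card_of_nodup a1']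
      congr 1; ext x; simp [a2, a2']
    obtain ⟨rfl, rfl⟩ := List.append_inj e hl
    rfl
  · intro l h
    simp only [Finset.mem_filter, mem_AL] at h
    obtain ⟨⟨⟨a1, a2⟩, a3⟩, a4⟩ := h
    have e := split_of_A3 (t := t) (l := l) (by rw [a2]; exact ht) (A3_snoc.1 a4).2
    refine ⟨(l.filter (· < t), l.filter (t < ·)), ?_, e.symm⟩
    simp only [Finset.mem_product, mem_AL]
    refine ⟨⟨⟨a1.filter _, ?_⟩, A3_of_sublist List.filter_sublist a3⟩,
      ⟨a1.filter _, ?_⟩, A3_of_sublist List.filter_sublist a3⟩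
    · intro x; simp [a2]
    · intro x; simp [a2]

open scoped Classical in
lemma card_AL_sum (s : Finset ℕ) (hs : s.Nonempty) :
    (AL s).card = ∑ b ∈ s, ((AL (s.erase b)).filter (fun p => A3 (p ++ [b]))).card := by
  rw [← Finset.card_sigma]
  symm
  apply Finset.card_bij (fun p _ => p.2 ++ [p.1])
  · rintro ⟨b, p⟩ h
    simp only [Finset.mem_sigma, Finset.mem_filter, mem_AL, Finset.mem_erase] at h ⊢
    obtain ⟨hb, ⟨⟨h1, h2⟩, h3⟩, h4⟩ := h
    refine ⟨⟨?_, ?_⟩, h4⟩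
    · rw [List.nodup_append]
      refine ⟨h1, by simp, ?_⟩
      intro x hx y hy
      simp at hy; subst hy
      exact ((h2 x).1 hx).1
    · intro x; simp only [List.mem_append, h2, List.mem_singleton]
      by_cases e : x = b
      · subst e; simp [hb]
      · simp [e]
  · rintro ⟨b, p⟩ h ⟨b', p'⟩ h' e
    simp only [List.append_eq_append_iff] at e
    obtain ⟨h1, h2⟩ := List.append_inj' (show p ++ [b] = p' ++ [b'] by simpa [List.append_eq_append_iff] using e) rfl
    simp at h2; subst h1; subst h2; rfl
  · intro l h
    rw [mem_AL] at h
    obtain ⟨⟨h1, h2⟩, h3⟩ := h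
    have hne : l ≠ [] := by
      rintro rfl
      obtain ⟨x, hx⟩ := hs
      exact absurd ((h2 x).2 hx) (by simp)
    obtain ⟨p, b, rfl⟩ : ∃ p b, l = p ++ [b] := ⟨_, _, (List.dropLast_append_getLast hne).symm⟩
    refine ⟨⟨b, p⟩, ?_, rfl⟩
    rw [List.nodup_append] at h1
    simp only [Finset.mem_sigma, Finset.mem_filter, mem_AL, Finset.mem_erase]
    refine ⟨(h2 b).1 (by simp), ⟨⟨h1.1, fun x => ?_⟩,
      A3_of_sublist (List.sublist_append_left _ _) h3⟩, h3⟩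
    rw [← h2 x]
    constructor
    · intro hx; exact ⟨h1.2.2 x hx b (by simp), by simp [hx]⟩
    · rintro ⟨a, b⟩; simpa [a] using b

lemma sum_card_lt (s : Finset ℕ) (f : ℕ → ℕ → ℕ) (n : ℕ) (hn : s.card = n + 1) :
    ∑ b ∈ s, f (s.filter (· < b)).card (s.filter (b < ·)).card
      = ∑ ij ∈ Finset.HasAntidiagonal.antidiagonal n, f ij.1 ij.2 := by
  have hadd : ∀ b ∈ s, (s.filter (· < b)).card + (s.filter (b < ·)).card = n := by
    intro b hb
    have h1 : (s.filter (· < b)) ∪ (s.filter (b < ·)) = s.erase b := by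
      ext x; simp only [Finset.mem_union, Finset.mem_filter, Finset.mem_erase]
      have : x ≠ b ↔ x < b ∨ b < x := by omega
      tauto
    rw [← Finset.card_union_of_disjoint, h1, Finset.card_erase_of_mem hb, hn]; rfl
    rw [Finset.disjoint_left]; intro x; simp only [Finset.mem_filter]; omega
  have hinj : Set.InjOn (fun b => ((s.filter (· < b)).card, (s.filter (b < ·)).card)) s := by
    have hlt : ∀ x ∈ s, ∀ y ∈ s, x < y → (s.filter (· < x)).card < (s.filter (· < y)).card := by
      intro x hx y hy hxy
      apply Finset.card_lt_card
      rw [Finset.ssubset_iff_of_subset]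
      · exact ⟨x, by simp [hx, hxy], by simp⟩
      · intro z; simp only [Finset.mem_filter]; rintro ⟨h, h'⟩; exact ⟨h, by omega⟩
    intro x hx y hy e
    simp only [Prod.mk.injEq] at e
    rcases lt_trichotomy x y with h | h | h
    · have := hlt x hx y hy h; omega
    · exact h
    · have := hlt y hy x hx h; omega
  have himg : s.image (fun b => ((s.filter (· < b)).card, (s.filter (b < ·)).card))
      = Finset.HasAntidiagonal.antidiagonal n := by
    apply Finset.eq_of_subset_of_card_le
    · intro p hp
      rw [Finset.mem_image] at hp
      obtain ⟨b, hb, rfl⟩ := hp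
      simpa using hadd b hb
    · rw [Finset.card_image_of_injOn hinj, hn]; simp
  rw [← himg, Finset.sum_image hinj]

lemma card_AL : ∀ (n : ℕ) (s : Finset ℕ), s.card = n → (AL s).card = catalan n := by
  intro n
  induction n using Nat.strong_induction_on with
  | _ n ih =>
  intro s hs
  cases n with
  | zero =>
    rw [Finset.card_eq_zero] at hs; subst hs
    rw [catalan_zero, Finset.card_eq_one]
    refine ⟨[], ?_⟩
    ext l
    rw [mem_AL, Finset.mem_singleton]
    constructor
    · rintro ⟨⟨_, h⟩, _⟩
      rw [List.eq_nil_iff_forall_not_mem]; simpa using h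
    · rintro rfl; simp [A3]
  | succ n =>
    rw [card_AL_sum s (by rw [← Finset.card_pos]; omega), catalan_succ',
      ← sum_card_lt s (fun i j => catalan i * catalan j) n hs]
    apply Finset.sum_congr rfl
    intro b hb
    rw [card_W _ _ (by simp)]
    have e1 : (s.erase b).filter (· < b) = s.filter (· < b) := by
      ext x; simp only [Finset.mem_filter, Finset.mem_erase]
      constructor
      · tauto
      · rintro ⟨h1, h2⟩; exact ⟨⟨by omega, h1⟩, h2⟩
    have e2 : (s.erase b).filter (b < ·) = s.filter (b < ·) := by
      ext x; simp only [Finset.mem_filter, Finset.mem_erase]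
      constructor
      · tauto
      · rintro ⟨h1, h2⟩; exact ⟨⟨by omega, h1⟩, h2⟩
    have c1 : (s.filter (· < b)).card < n + 1 := by
      rw [← hs]; apply Finset.card_lt_card
      rw [Finset.ssubset_iff_of_subset (Finset.filter_subset _ _)]
      exact ⟨b, hb, by simp⟩
    have c2 : (s.filter (b < ·)).card < n + 1 := by
      rw [← hs]; apply Finset.card_lt_card
      rw [Finset.ssubset_iff_of_subset (Finset.filter_subset _ _)]
      exact ⟨b, hb, by simp⟩
    rw [e1, e2, ih _ c1 _ rfl, ih _ c2 _ rfl]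

def K4 (l : List ℕ) : Prop :=
  (∀ a b c d, [a, b, c, d].Sublist l → ¬ (b < d ∧ d < c ∧ c < a)) ∧
  (∀ a b c d, [a, b, c, d].Sublist l → ¬ (d < b ∧ b < c ∧ c < a)) ∧
  (∀ a b c d e, [a, b, c, d, e].Sublist l → ¬ (b < c ∧ c < a ∧ a < e ∧ e < d)) ∧
  (∀ a b c d e, [a, b, c, d, e].Sublist l → ¬ (b < c ∧ c < e ∧ e < a ∧ a < d))

lemma tail_sub {a b c : ℕ} {r p q : List ℕ} (h : (a :: b :: c :: r).Sublist (p ++ q))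
    (hp : A3 p) (h1 : b < c) (h2 : c < a) : (c :: r).Sublist q := by
  rw [List.sublist_append_iff] at h
  obtain ⟨l1, l2, e, s1, s2⟩ := h
  rw [List.cons_eq_append_iff] at e
  rcases e with ⟨rfl, rfl⟩ | ⟨m1, rfl, e⟩
  · exact List.Sublist.trans ((List.sublist_cons_self _ _).trans (List.sublist_cons_self _ _)) s2
  rw [List.cons_eq_append_iff] at e
  rcases e with ⟨rfl, rfl⟩ | ⟨m2, rfl, e⟩
  · exact List.Sublist.trans (List.sublist_cons_self _ _) s2
  rw [List.cons_eq_append_iff] at e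
  rcases e with ⟨rfl, rfl⟩ | ⟨m3, rfl, e⟩
  · exact s2
  · exact absurd ⟨h1, h2⟩ (hp a b c (List.Sublist.trans (by simp) s1))

lemma K4_append {p q : List ℕ} (hp : A3 p) (hq : q.Pairwise (· < ·)) : K4 (p ++ q) := by
  rw [List.pairwise_iff_forall_sublist] at hq
  refine ⟨?_, ?_, ?_, ?_⟩
  · intro a b c d h hh
    have := hq (tail_sub h hp (by omega) (by omega))
    omega
  · intro a b c d h hh
    have := hq (tail_sub h hp (by omega) (by omega))
    omega
  · intro a b c d e h hh
    have := hq ((List.sublist_cons_self _ _).trans (tail_sub h hp (by omega) (by omega)))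
    omega
  · intro a b c d e h hh
    have := hq ((List.sublist_cons_self _ _).trans (tail_sub h hp (by omega) (by omega)))
    omega

lemma K4_of_A3 {l : List ℕ} (h : A3 l) : K4 l := by
  simpa using K4_append h (q := []) (by simp)

lemma K4_sorted {p q : List ℕ} {x : ℕ} (hK : K4 (p ++ x :: q)) (hn : (p ++ x :: q).Nodup)
    (hp : A3 p) (hx : ¬ A3 (p ++ [x])) : (x :: q).Pairwise (· < ·) := by
  rw [A3_snoc] at hx
  push Not at hx
  obtain ⟨a, b, hab, hbx, hxa⟩ := hx hp
  obtain ⟨k1, k2, k3, k4⟩ := hK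
  rw [List.nodup_append] at hn
  obtain ⟨n1, n2, n3⟩ := hn
  have ha : a ∈ p := hab.subset (by simp)
  have hb : b ∈ p := hab.subset (by simp)
  have hxq : ∀ y ∈ q, x < y := by
    intro y hy
    have hs : [a, b, x, y].Sublist (p ++ x :: q) :=
      List.Sublist.append hab (show [x, y].Sublist (x :: q) by simpa using hy)
    have h1 := k1 _ _ _ _ hs
    have h2 := k2 _ _ _ _ hs
    have h3 := n3 b hb y (by simp [hy])
    have h4 : x ≠ y := by
      rintro rfl
      simp [hy] at n2
    omega
  rw [List.pairwise_cons]
  refine ⟨hxq, ?_⟩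
  rw [List.pairwise_iff_forall_sublist]
  intro y z hyz
  have hs : [a, b, x, y, z].Sublist (p ++ x :: q) :=
    List.Sublist.append hab (show [x, y, z].Sublist (x :: q) from hyz.cons_cons x)
  have hs' : [a, b, y, z].Sublist (p ++ x :: q) :=
    List.Sublist.append hab (show [y, z].Sublist (x :: q) from hyz.cons x)
  have h1 := k1 _ _ _ _ hs'
  have h3 := k3 _ _ _ _ _ hs
  have h4 := k4 _ _ _ _ _ hs
  have hy : y ∈ q := hyz.subset (by simp)
  have hz : z ∈ q := hyz.subset (by simp)
  have h5 := n3 a ha y (by simp [hy])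
  have h6 := n3 a ha z (by simp [hz])
  have h7 := hxq y hy
  have h8 := hxq z hz
  have h9 : y ≠ z := by
    have n4 := (List.nodup_cons.1 n2).2
    have := hyz.nodup n4
    simpa using this
  omega

lemma exists_first (l : List ℕ) : ¬ A3 l →
    ∃ p x q, l = p ++ x :: q ∧ A3 p ∧ ¬ A3 (p ++ [x]) := by
  induction l using List.reverseRecOn with
  | nil => intro h; exact absurd (by simp [A3]) h
  | append_singleton l y ih =>
    intro h
    by_cases hl : A3 l
    · exact ⟨l, y, [], by simp, hl, h⟩
    · obtain ⟨p, x, q, rfl, h1, h2⟩ := ih hl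
      exact ⟨p, x, q ++ [y], by simp, h1, h2⟩

lemma first_unique {p q p' q' : List ℕ} {x x' : ℕ} (e : p ++ x :: q = p' ++ x' :: q')
    (h1 : A3 p) (h2 : ¬ A3 (p ++ [x])) (h1' : A3 p') (h2' : ¬ A3 (p' ++ [x'])) :
    p = p' ∧ x = x' ∧ q = q' := by
  rw [List.append_eq_append_iff] at e
  rcases e with ⟨as, rfl, e⟩ | ⟨as, rfl, e⟩
  · rw [List.cons_eq_append_iff] at e
    rcases e with ⟨rfl, e⟩ | ⟨as', rfl, e⟩
    · simp_all
    · exact absurd (A3_of_sublist (by simp) h1') h2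
  · rw [List.cons_eq_append_iff] at e
    rcases e with ⟨rfl, e⟩ | ⟨as', rfl, e⟩
    · simp_all
    · exact absurd (A3_of_sublist (by simp) h1) h2'

open scoped Classical in
noncomputable def KL (s : Finset ℕ) : Finset (List ℕ) := (PL s).filter K4

lemma mem_KL {s : Finset ℕ} {l : List ℕ} :
    l ∈ KL s ↔ (l.Nodup ∧ ∀ x, x ∈ l ↔ x ∈ s) ∧ K4 l := by
  classical
  unfold KL; rw [Finset.mem_filter, mem_PL]

open scoped Classical in
lemma card_KL_not (n : ℕ) :
    ((KL (Finset.range n)).filter (fun l => ¬ A3 l)).card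
      = ∑ t ∈ Finset.range n, ∑ V ∈ (Finset.Ioo t n).powerset,
        ((AL (Finset.range t ∪ V)).filter (fun p => ¬ A3 (p ++ [t]))).card := by
  have : ∀ t ∈ Finset.range n, ∑ V ∈ (Finset.Ioo t n).powerset,
        ((AL (Finset.range t ∪ V)).filter (fun p => ¬ A3 (p ++ [t]))).card
      = ((Finset.Ioo t n).powerset.sigma
        (fun V => (AL (Finset.range t ∪ V)).filter (fun p => ¬ A3 (p ++ [t])))).card := by
    intro t _; rw [Finset.card_sigma]
  rw [Finset.sum_congr rfl this, ← Finset.card_sigma]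
  symm
  apply Finset.card_bij
    (fun (x : Σ _ : ℕ, Σ _ : Finset ℕ, List ℕ) _ =>
      x.2.2 ++ x.1 :: ((Finset.Ioo x.1 n) \ x.2.1).sort (· ≤ ·))
  · rintro ⟨t, V, p⟩ h
    simp only [Finset.mem_sigma, Finset.mem_filter, mem_AL, mem_KL, Finset.mem_powerset,
      Finset.mem_range, Finset.mem_union] at h ⊢
    obtain ⟨ht, hV, ⟨⟨h1, h2⟩, h3⟩, h4⟩ := h
    have hV' : ∀ x ∈ V, t < x ∧ x < n := fun x hx => by simpa using hV hx
    have hsort : (t :: ((Finset.Ioo t n) \ V).sort (· ≤ ·)).Pairwise (· < ·) := by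
      rw [List.pairwise_cons]
      refine ⟨?_, (Finset.sortedLT_sort _).pairwise⟩
      intro x hx
      simp only [Finset.mem_sort, Finset.mem_sdiff, Finset.mem_Ioo] at hx
      exact hx.1.1
    refine ⟨⟨⟨?_, ?_⟩, K4_append h3 hsort⟩, ?_⟩
    · rw [List.nodup_append]
      refine ⟨h1, hsort.imp (fun h => h.ne), ?_⟩
      intro x hx y hy
      rw [h2] at hx
      simp only [List.mem_cons, Finset.mem_sort, Finset.mem_sdiff, Finset.mem_Ioo] at hy
      rintro rfl
      rcases hx with hx | hx
      · omega
      · have := hV' x hx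
        rcases hy with hy | hy
        · omega
        · exact hy.2 hx
    · intro x
      simp only [List.mem_append, h2, List.mem_cons, Finset.mem_sort, Finset.mem_sdiff,
        Finset.mem_Ioo]
      by_cases hx : x ∈ V
      · have := hV' x hx
        simp [hx]; omega
      · simp [hx]; omega
    · intro h
      exact h4 (A3_of_sublist (by simp) h)
  · rintro ⟨t, V, p⟩ h ⟨t', V', p'⟩ h' e
    simp only [Finset.mem_sigma, Finset.mem_filter, mem_AL, mem_KL, Finset.mem_powerset,
      Finset.mem_range, Finset.mem_union] at h h' e
    obtain ⟨ht, hV, ⟨⟨h1, h2⟩, h3⟩, h4⟩ := h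
    obtain ⟨ht', hV', ⟨⟨h1', h2'⟩, h3'⟩, h4'⟩ := h'
    obtain ⟨rfl, rfl, _⟩ := first_unique e h3 h4 h3' h4'
    have : V = V' := by
      ext x
      have a1 := h2 x
      have a2 := h2' x
      have a3 : x ∈ V → t < x := fun hx => by have := hV hx; simp at this; exact this.1
      have a4 : x ∈ V' → t < x := fun hx => by have := hV' hx; simp at this; exact this.1
      have a5 : t < x → ¬ x < t := by omega
      tauto
    subst this; rfl
  · intro l h
    simp only [Finset.mem_filter, mem_KL, Finset.mem_range] at h
    obtain ⟨⟨⟨h1, h2⟩, h3⟩, h4⟩ := h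
    obtain ⟨p, t, q, rfl, hp, hpt⟩ := exists_first l h4
    have hs := K4_sorted h3 h1 hp hpt
    have hs' := hs
    rw [List.pairwise_cons] at hs'
    rw [List.nodup_append] at h1
    obtain ⟨n1, n2, n3⟩ := h1
    have hq : ((Finset.Ioo t n) \ (p.toFinset.filter (t < ·))).sort (· ≤ ·) = q := by
      apply List.Perm.eq_of_pairwise (le := (· < ·))
      · intro a b _ _ h h'; omega
      · exact (Finset.sortedLT_sort _).pairwise
      · exact hs'.2
      · rw [List.perm_ext_iff_of_nodup (Finset.sort_nodup _ _) (List.nodup_cons.1 n2).2]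
        intro x
        simp only [Finset.mem_sort, Finset.mem_sdiff, Finset.mem_Ioo, Finset.mem_filter,
          List.mem_toFinset]
        have b1 := h2 x
        simp only [List.mem_append, List.mem_cons] at b1
        constructor
        · rintro ⟨⟨c1, c2⟩, c3⟩
          rcases b1.2 c2 with c | c | c
          · exact absurd ⟨c, c1⟩ c3
          · omega
          · exact c
        · intro c
          exact ⟨⟨hs'.1 x c, b1.1 (by simp [c])⟩, fun d => n3 x d.1 x (by simp [c]) rfl⟩
    refine ⟨⟨t, p.toFinset.filter (t < ·), p⟩, ?_, by simp only [hq]⟩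
    simp only [Finset.mem_sigma, Finset.mem_filter, mem_AL, Finset.mem_powerset,
      Finset.mem_range, Finset.mem_union, List.mem_toFinset]
    refine ⟨(h2 t).1 (by simp), ?_, ⟨⟨n1, ?_⟩, hp⟩, hpt⟩
    · intro x
      simp only [Finset.mem_filter, List.mem_toFinset, Finset.mem_Ioo]
      rintro ⟨c1, c2⟩
      exact ⟨c2, (h2 x).1 (by simp [c1])⟩
    · intro x
      constructor
      · intro hx
        have := n3 x hx t (by simp)
        rcases lt_or_gt_of_ne this with h | h
        · exact Or.inl h
        · exact Or.inr ⟨hx, h⟩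
      · rintro (h | h)
        · have htn := (h2 t).1 (by simp)
          have := (h2 x).2 (by omega)
          simp only [List.mem_append, List.mem_cons] at this
          rcases this with c | c | c
          · exact c
          · omega
          · have := hs'.1 x c; omega
        · exact h.1

open scoped Classical in
lemma card_KL (n : ℕ) :
    ((KL (Finset.range n)).card : ℚ) = catalan n
      + ∑ t ∈ Finset.range n, ∑ j ∈ Finset.range (n - t), ((n - 1 - t).choose j : ℚ) *
        ((catalan (t + j) : ℚ) - catalan t * catalan j) := by
  have h1 : (KL (Finset.range n)).filter A3 = AL (Finset.range n) := by
    ext l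
    rw [Finset.mem_filter, mem_KL, mem_AL]
    have := @K4_of_A3 l
    tauto
  rw [← Finset.card_filter_add_card_filter_not (s := KL (Finset.range n)) A3, h1, card_AL n _ (by simp),
    card_KL_not]
  push_cast
  congr 1
  apply Finset.sum_congr rfl
  intro t ht
  rw [Finset.mem_range] at ht
  have key : ∀ V ∈ (Finset.Ioo t n).powerset,
      (((AL (Finset.range t ∪ V)).filter (fun p => ¬ A3 (p ++ [t]))).card : ℚ)
        = (fun j => (catalan (t + j) : ℚ) - catalan t * catalan j) V.card := by
    intro V hV
    rw [Finset.mem_powerset] at hV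
    have hV' : ∀ x ∈ V, t < x ∧ x < n := fun x hx => by simpa using hV hx
    have e := Finset.card_filter_add_card_filter_not (s := AL (Finset.range t ∪ V))
      (fun p => A3 (p ++ [t]))
    have f1 : (Finset.range t ∪ V).filter (· < t) = Finset.range t := by
      ext x
      simp only [Finset.mem_filter, Finset.mem_union, Finset.mem_range]
      constructor
      · tauto
      · tauto
    have f2 : (Finset.range t ∪ V).filter (t < ·) = V := by
      ext x
      simp only [Finset.mem_filter, Finset.mem_union, Finset.mem_range]
      constructor
      · rintro ⟨h | h, h'⟩
        · omega
        · exact h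
      · intro h; exact ⟨Or.inr h, (hV' x h).1⟩
    have f3 : (Finset.range t ∪ V).card = t + V.card := by
      rw [Finset.card_union_of_disjoint, Finset.card_range]
      rw [Finset.disjoint_left]
      intro x hx hx'
      have := hV' x hx'
      simp at hx; omega
    rw [card_W _ _ (by
      simp only [Finset.mem_union, Finset.mem_range, lt_irrefl, false_or]
      intro h; exact absurd (hV' t h).1 (by simp)), f1, f2, card_AL _ _ f3,
      card_AL _ _ (Finset.card_range t), card_AL _ V rfl] at e
    have e' := congrArg (Nat.cast : ℕ → ℚ) e
    push_cast at e'
    linarith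
  rw [Finset.sum_congr rfl key, Finset.sum_powerset_apply_card
    (fun j => (catalan (t + j) : ℚ) - catalan t * catalan j), Nat.card_Ioo]
  rw [show n - t - 1 + 1 = n - t by omega, show n - t - 1 = n - 1 - t by omega]
  simp [nsmul_eq_mul]

lemma ofFn_sublist {α : Type*} {m n : ℕ} (h : Fin m → α) (g : Fin n → α) :
    (List.ofFn h).Sublist (List.ofFn g) ↔
      ∃ f : Fin m → Fin n, StrictMono f ∧ ∀ s, h s = g (f s) := by
  rw [List.sublist_iff_exists_fin_orderEmbedding_get_eq]
  constructor
  · rintro ⟨f, hf⟩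
    refine ⟨fun s => (f (s.cast (by simp))).cast (by simp), ?_, ?_⟩
    · intro a b hab
      have : (a.cast (by simp) : Fin (List.ofFn h).length) < b.cast (by simp) := by
        simpa using hab
      have := f.strictMono this
      simpa using this
    · intro s
      have := hf (s.cast (by simp))
      simp only [List.get_ofFn] at this
      exact this
  · rintro ⟨f, hf, e⟩
    refine ⟨OrderEmbedding.ofStrictMono
      (fun s => (f (s.cast (by simp))).cast (by simp)) ?_, ?_⟩
    · intro a b hab
      have : (a.cast (by simp) : Fin m) < b.cast (by simp) := by simpa using hab
      simpa using hf this
    · intro s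
      have := e (s.cast (by simp))
      simp only [List.get_ofFn]
      exact this

def permList {n : ℕ} (σ : Equiv.Perm (Fin n)) : List ℕ := List.ofFn (fun i => (σ i : ℕ))

lemma contains_iff {n m : ℕ} (σ : Equiv.Perm (Fin n)) (π : Equiv.Perm (Fin m)) :
    Contains σ π ↔ ∃ h : Fin m → ℕ, (List.ofFn h).Sublist (permList σ) ∧
      ∀ s t, h s < h t ↔ π s < π t := by
  unfold Contains ContainsIn permList
  constructor
  · rintro ⟨f, hf, -, hh⟩
    refine ⟨fun s => (σ (f s) : ℕ), ?_, ?_⟩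
    · rw [ofFn_sublist]; exact ⟨f, hf, fun _ => rfl⟩
    · intro s t; rw [← hh]; rfl
  · rintro ⟨h, hs, hh⟩
    rw [ofFn_sublist] at hs
    obtain ⟨f, hf, e⟩ := hs
    refine ⟨f, hf, fun _ => Set.mem_univ _, ?_⟩
    intro s t
    rw [← hh, e, e]; rfl

lemma contains_iff4 {n : ℕ} (σ : Equiv.Perm (Fin n)) (π : Equiv.Perm (Fin 4)) :
    Contains σ π ↔ ∃ a b c d : ℕ, [a, b, c, d].Sublist (permList σ) ∧
      ∀ s t, (![a, b, c, d] : Fin 4 → ℕ) s < ![a, b, c, d] t ↔ π s < π t := by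
  rw [contains_iff]
  constructor
  · rintro ⟨h, hs, hh⟩
    refine ⟨h 0, h 1, h 2, h 3, by simpa [List.ofFn_succ] using hs, ?_⟩
    have : ![h 0, h 1, h 2, h 3] = h := by
      ext i; fin_cases i <;> rfl
    rw [this]; exact hh
  · rintro ⟨a, b, c, d, hs, hh⟩
    exact ⟨![a, b, c, d], by simpa [List.ofFn_succ] using hs, hh⟩

lemma contains_iff5 {n : ℕ} (σ : Equiv.Perm (Fin n)) (π : Equiv.Perm (Fin 5)) :
    Contains σ π ↔ ∃ a b c d e : ℕ, [a, b, c, d, e].Sublist (permList σ) ∧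
      ∀ s t, (![a, b, c, d, e] : Fin 5 → ℕ) s < ![a, b, c, d, e] t ↔ π s < π t := by
  rw [contains_iff]
  constructor
  · rintro ⟨h, hs, hh⟩
    refine ⟨h 0, h 1, h 2, h 3, h 4, by simpa [List.ofFn_succ] using hs, ?_⟩
    have : ![h 0, h 1, h 2, h 3, h 4] = h := by
      ext i; fin_cases i <;> rfl
    rw [this]; exact hh
  · rintro ⟨a, b, c, d, e, hs, hh⟩
    exact ⟨![a, b, c, d, e], by simpa [List.ofFn_succ] using hs, hh⟩

lemma pat4132 (a b c d : ℕ) :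
    (∀ s t, (![a, b, c, d] : Fin 4 → ℕ) s < ![a, b, c, d] t ↔ p4132 s < p4132 t)
      ↔ (b < d ∧ d < c ∧ c < a) := by
  simp [Fin.forall_fin_succ, p4132]
  omega

lemma pat4231 (a b c d : ℕ) :
    (∀ s t, (![a, b, c, d] : Fin 4 → ℕ) s < ![a, b, c, d] t ↔ p4231 s < p4231 t)
      ↔ (d < b ∧ b < c ∧ c < a) := by
  simp [Fin.forall_fin_succ, p4231]
  omega

lemma pat31254 (a b c d e : ℕ) :
    (∀ s t, (![a, b, c, d, e] : Fin 5 → ℕ) s < ![a, b, c, d, e] t ↔ p31254 s < p31254 t)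
      ↔ (b < c ∧ c < a ∧ a < e ∧ e < d) := by
  simp [Fin.forall_fin_succ, p31254]
  omega

lemma pat41253 (a b c d e : ℕ) :
    (∀ s t, (![a, b, c, d, e] : Fin 5 → ℕ) s < ![a, b, c, d, e] t ↔ p41253 s < p41253 t)
      ↔ (b < c ∧ c < e ∧ e < a ∧ a < d) := by
  simp [Fin.forall_fin_succ, p41253]
  omega

lemma avoids_iff {n : ℕ} (σ : Equiv.Perm (Fin n)) :
    (Avoids σ p4132 ∧ Avoids σ p4231 ∧ Avoids σ p31254 ∧ Avoids σ p41253) ↔ K4 (permList σ) := by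
  unfold Avoids K4
  simp only [contains_iff4, contains_iff5, pat4132, pat4231, pat31254, pat41253, not_exists]
  simp only [not_and]

lemma card_eq_KL (n : ℕ) :
    Nat.card {σ : Equiv.Perm (Fin n) // Avoids σ p4132 ∧ Avoids σ p4231 ∧ Avoids σ p31254 ∧
      Avoids σ p41253} = (KL (Finset.range n)).card := by
  rw [← Nat.card_eq_finsetCard]
  have hmem : ∀ σ : {σ : Equiv.Perm (Fin n) // Avoids σ p4132 ∧ Avoids σ p4231 ∧
      Avoids σ p31254 ∧ Avoids σ p41253}, permList σ.1 ∈ KL (Finset.range n) := by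
    intro σ
    rw [mem_KL]
    refine ⟨⟨?_, ?_⟩, (avoids_iff σ.1).1 σ.2⟩
    · unfold permList
      rw [List.nodup_ofFn]
      intro i j e
      exact σ.1.injective (Fin.ext e)
    · intro x
      unfold permList
      rw [List.mem_ofFn, Finset.mem_range]
      constructor
      · rintro ⟨i, rfl⟩; exact (σ.1 i).2
      · intro hx
        exact ⟨σ.1.symm ⟨x, hx⟩, by simp⟩
  apply Nat.card_eq_of_bijective (fun σ => ⟨permList σ.1, hmem σ⟩)
  · constructor
    · rintro ⟨σ, h⟩ ⟨τ, h'⟩ e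
      simp only [Subtype.mk.injEq, permList] at e ⊢
      have := List.ofFn_injective e
      ext i
      exact congrFun this i
    · rintro ⟨l, hl⟩
      have hl' := hl
      rw [mem_KL] at hl'
      obtain ⟨⟨h1, h2⟩, h3⟩ := hl'
      have hlen : l.length = n := by
        rw [← List.toFinset_card_of_nodup h1, show l.toFinset = Finset.range n by ext x; simp [h2]]
        simp
      subst hlen
      have hlt : ∀ i : Fin l.length, l.get i < l.length := fun i => by
        simpa using (h2 (l.get i)).1 (List.get_mem _ _)
      let g : Fin l.length → Fin l.length := fun i => ⟨l.get i, hlt i⟩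
      have hg : Function.Injective g := by
        intro i j e
        exact h1.injective_get (by simpa [g] using e)
      let σ : Equiv.Perm (Fin l.length) := Equiv.ofBijective g (Finite.injective_iff_bijective.1 hg)
      have hσ : permList σ = l := by
        unfold permList
        exact List.ofFn_get l
      exact ⟨⟨σ, by rw [avoids_iff, hσ]; exact h3⟩, by simp [hσ]⟩


/-- formal infinite sum of a family `f` with `X ^ r ∣ f r` -/
noncomputable def SS (f : ℕ → PowerSeries ℚ) : PowerSeries ℚ :=
  PowerSeries.mk fun n => ∑ r ∈ Finset.range (n + 1), PowerSeries.coeff n (f r)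

lemma SS_coeff {f : ℕ → PowerSeries ℚ} (hf : ∀ r, PowerSeries.X ^ r ∣ f r) {n N : ℕ} (h : n < N) :
    PowerSeries.coeff n (SS f) = PowerSeries.coeff n (∑ r ∈ Finset.range N, f r) := by
  rw [SS, PowerSeries.coeff_mk, map_sum]
  apply Finset.sum_subset
  · intro x; simp only [Finset.mem_range]; omega
  · intro r _ hr
    exact PowerSeries.X_pow_dvd_iff.1 (hf r) n (by simpa using hr)

lemma SS_add (f g : ℕ → PowerSeries ℚ) : SS (fun r => f r + g r) = SS f + SS g := by
  ext n; simp [SS, Finset.sum_add_distrib]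

lemma SS_sub (f g : ℕ → PowerSeries ℚ) : SS (fun r => f r - g r) = SS f - SS g := by
  ext n; simp [SS, Finset.sum_sub_distrib]

lemma coeff_mul_congr {n : ℕ} {a a' b b' : PowerSeries ℚ}
    (ha : ∀ k < n + 1, PowerSeries.coeff k a = PowerSeries.coeff k a')
    (hb : ∀ k < n + 1, PowerSeries.coeff k b = PowerSeries.coeff k b') :
    PowerSeries.coeff n (a * b) = PowerSeries.coeff n (a' * b') := by
  rw [PowerSeries.coeff_mul, PowerSeries.coeff_mul]
  apply Finset.sum_congr rfl
  rintro ⟨i, j⟩ h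
  rw [Finset.HasAntidiagonal.mem_antidiagonal] at h
  rw [ha _ (by simp only at h ⊢; omega), hb _ (by simp only at h ⊢; omega)]

lemma SS_mul_left (a : PowerSeries ℚ) {f : ℕ → PowerSeries ℚ} (hf : ∀ r, PowerSeries.X ^ r ∣ f r) :
    SS (fun r => a * f r) = a * SS f := by
  ext n
  rw [SS_coeff (fun r => (hf r).mul_left a) (Nat.lt_succ_self n), ← Finset.mul_sum]
  exact coeff_mul_congr (fun _ _ => rfl) (fun k hk => (SS_coeff hf hk).symm)

lemma SS_mul {f g : ℕ → PowerSeries ℚ} (hf : ∀ r, PowerSeries.X ^ r ∣ f r)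
    (hg : ∀ r, PowerSeries.X ^ r ∣ g r) :
    SS (fun r => ∑ k ∈ Finset.range (r + 1), f k * g (r - k)) = SS f * SS g := by
  have hd : ∀ i j, PowerSeries.X ^ (i + j) ∣ f i * g j := fun i j => by
    rw [pow_add]; exact mul_dvd_mul (hf i) (hg j)
  ext n
  rw [SS_coeff (N := n + 1) _ (Nat.lt_succ_self n)]
  · rw [coeff_mul_congr (fun k hk => SS_coeff hf hk) (fun k hk => SS_coeff hg hk),
      Finset.sum_range_diag_flip (n + 1) (fun i j => f i * g j), Finset.sum_mul]
    simp only [Finset.mul_sum, map_sum]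
    apply Finset.sum_congr rfl
    intro i hi
    apply Finset.sum_subset
    · intro x; simp only [Finset.mem_range]; omega
    · intro j _ hj
      exact PowerSeries.X_pow_dvd_iff.1 (hd i j) n (by simp at hj hi; omega)
  · intro r
    apply Finset.dvd_sum
    intro k hk
    have := hd k (r - k)
    rwa [show k + (r - k) = r by simp at hk; omega] at this

lemma SS_shift {f : ℕ → PowerSeries ℚ} (hf : ∀ r, PowerSeries.X ^ r ∣ f r) :
    SS f = f 0 + SS (fun r => f (r + 1)) := by
  ext n
  rw [SS_coeff (N := n + 2) hf (by omega), Finset.sum_range_succ', map_add, map_add, add_comm,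
    SS_coeff (N := n + 1) (fun r => (pow_dvd_pow _ (Nat.le_succ r)).trans (hf (r + 1))) (by omega)]

noncomputable def ee : PowerSeries ℚ := PowerSeries.mk 1
noncomputable def ww : PowerSeries ℚ := PowerSeries.X * ee

lemma X_dvd_ww (r : ℕ) : PowerSeries.X ^ r ∣ ww ^ r := pow_dvd_pow_of_dvd (Dvd.intro _ rfl) r

noncomputable def catS (v : PowerSeries ℚ) : PowerSeries ℚ :=
  SS (fun r => PowerSeries.C (catalan r : ℚ) * v ^ r)

lemma catS_eq {v : PowerSeries ℚ} (hv : PowerSeries.X ∣ v) :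
    catS v = 1 + v * catS v ^ 2 := by
  have h : ∀ r, PowerSeries.X ^ r ∣ PowerSeries.C (catalan r : ℚ) * v ^ r := fun r =>
    (pow_dvd_pow_of_dvd hv r).mul_left _
  have h2 : catS v ^ 2 = SS (fun r => PowerSeries.C (catalan (r + 1) : ℚ) * v ^ r) := by
    rw [sq]; unfold catS
    rw [← SS_mul h h]
    congr 1; ext1 r
    rw [catalan_succ', Finset.Nat.sum_antidiagonal_eq_sum_range_succ (fun i j => catalan i * catalan j)]
    push_cast
    rw [map_sum, Finset.sum_mul]
    apply Finset.sum_congr rfl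
    intro k hk
    have : v ^ r = v ^ k * v ^ (r - k) := by
      rw [← pow_add]; congr 1; simp at hk; omega
    rw [this, map_mul]; ring
  rw [h2, ← SS_mul_left _ (fun r => (pow_dvd_pow_of_dvd hv r).mul_left _)]
  conv_lhs => unfold catS
  rw [SS_shift h]
  simp only [catalan_zero, Nat.cast_one, map_one, pow_zero, mul_one]
  congr 2; ext1 r
  rw [pow_succ]; ring

noncomputable def GG : PowerSeries ℚ :=
  SS (fun r => ∑ k ∈ Finset.range (r + 1),
    PowerSeries.C (catalan r : ℚ) * (PowerSeries.X ^ k * ww ^ (r - k)))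

lemma dvd_term (a : PowerSeries ℚ) {k r : ℕ} (hk : k ∈ Finset.range (r + 1)) :
    PowerSeries.X ^ r ∣ a * (PowerSeries.X ^ k * ww ^ (r - k)) := by
  apply Dvd.dvd.mul_left
  have h := mul_dvd_mul (dvd_refl (PowerSeries.X ^ k : PowerSeries ℚ)) (X_dvd_ww (r - k))
  rwa [← pow_add, show k + (r - k) = r by simp at hk; omega] at h

lemma GG_eq : (ww - PowerSeries.X) * GG = ww * catS ww - PowerSeries.X * catS PowerSeries.X := by
  unfold GG catS
  rw [← SS_mul_left, ← SS_mul_left, ← SS_mul_left, ← SS_sub]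
  · congr 1; ext1 r
    have := geom_sum₂_mul (PowerSeries.X : PowerSeries ℚ) ww (r + 1)
    simp only [Nat.add_sub_cancel] at this
    rw [← Finset.mul_sum]
    linear_combination (-PowerSeries.C (catalan r : ℚ)) * this
  · intro r; exact Dvd.intro_left _ rfl
  · intro r; exact (X_dvd_ww r).mul_left _
  · intro r
    exact Finset.dvd_sum (fun k hk => dvd_term _ hk)

lemma cc_dd_eq : catS PowerSeries.X * catS ww =
    SS (fun r => ∑ k ∈ Finset.range (r + 1),
      PowerSeries.C ((catalan k : ℚ) * catalan (r - k)) * (PowerSeries.X ^ k * ww ^ (r - k))) := by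
  unfold catS
  rw [← SS_mul]
  · congr 1; ext1 r
    apply Finset.sum_congr rfl
    intro k _
    rw [map_mul]; ring
  · intro r; exact Dvd.intro_left _ rfl
  · intro r; exact (X_dvd_ww r).mul_left _

lemma coeff_term (n t j : ℕ) (ht : t < n) :
    PowerSeries.coeff n (PowerSeries.X ^ t * ww ^ (j + 1)) = ((n - 1 - t).choose j : ℚ) := by
  unfold ww ee
  rw [mul_pow, PowerSeries.mk_one_pow_eq_mk_choose_add, ← mul_assoc, ← pow_add,
    PowerSeries.coeff_X_pow_mul']
  split_ifs with h
  · rw [PowerSeries.coeff_mk]; congr 2; omega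
  · rw [Nat.choose_eq_zero_of_lt (by omega)]; simp

lemma F_eq : F = catS PowerSeries.X + ww * (GG - catS PowerSeries.X * catS ww) := by
  have hd : ∀ r, PowerSeries.X ^ r ∣ ∑ k ∈ Finset.range (r + 1),
      PowerSeries.C ((catalan (k + (r - k)) : ℚ) - (catalan k : ℚ) * catalan (r - k)) *
        (PowerSeries.X ^ k * ww ^ (r - k)) := fun r =>
    Finset.dvd_sum (fun k hk => dvd_term _ hk)
  have h1 : GG - catS PowerSeries.X * catS ww = SS (fun r => ∑ k ∈ Finset.range (r + 1),
      PowerSeries.C ((catalan (k + (r - k)) : ℚ) - (catalan k : ℚ) * catalan (r - k)) *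
        (PowerSeries.X ^ k * ww ^ (r - k))) := by
    rw [cc_dd_eq]; unfold GG
    rw [← SS_sub]
    congr 1; ext1 r
    rw [← Finset.sum_sub_distrib]
    apply Finset.sum_congr rfl
    intro k hk
    rw [show k + (r - k) = r by simp at hk; omega, map_sub]; ring
  rw [h1]
  ext n
  rw [F, PowerSeries.coeff_mk, card_eq_KL, card_KL, map_add]
  congr 1
  · unfold catS SS
    rw [PowerSeries.coeff_mk]
    simp only [PowerSeries.coeff_C_mul, PowerSeries.coeff_X_pow]
    simp
  · cases n with
    | zero => simp [ww]
    | succ n =>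
    have e : ww * SS (fun r => ∑ k ∈ Finset.range (r + 1),
      PowerSeries.C ((catalan (k + (r - k)) : ℚ) - (catalan k : ℚ) * catalan (r - k)) *
        (PowerSeries.X ^ k * ww ^ (r - k)))
        = PowerSeries.X * (ee * SS (fun r => ∑ k ∈ Finset.range (r + 1),
      PowerSeries.C ((catalan (k + (r - k)) : ℚ) - (catalan k : ℚ) * catalan (r - k)) *
        (PowerSeries.X ^ k * ww ^ (r - k)))) := by unfold ww; ring
    rw [e, PowerSeries.coeff_succ_X_mul, coeff_mul_congr (fun _ _ => rfl) (fun k hk => SS_coeff hd hk),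
      ← PowerSeries.coeff_succ_X_mul,
      Finset.sum_range_diag_flip (n + 1) (fun i j =>
        PowerSeries.C ((catalan (i + j) : ℚ) - (catalan i : ℚ) * catalan j) *
        (PowerSeries.X ^ i * ww ^ j)), ← mul_assoc, show PowerSeries.X * ee = ww from rfl]
    simp only [Finset.mul_sum, map_sum]
    apply Finset.sum_congr rfl
    intro t ht
    apply Finset.sum_congr rfl
    intro j _
    rw [← coeff_term (n + 1) t j (by simpa using ht), mul_comm, ← PowerSeries.coeff_C_mul]
    congr 1; ring

lemma one_sub_mul_ee : (1 - PowerSeries.X) * ee = 1 := by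
  unfold ee
  rw [mul_comm]; exact PowerSeries.mk_one_mul_one_sub_eq_one ℚ

theorem stmt : ∃ c d b m : PowerSeries ℚ,
    c = 1 + PowerSeries.X * c ^ 2 ∧
    (1 - PowerSeries.X) * d = (1 - PowerSeries.X) + PowerSeries.X * d ^ 2 ∧
    (1 - PowerSeries.X) * b
      = (1 - PowerSeries.X) * PowerSeries.X * c * b + PowerSeries.X ^ 2 ∧
    (1 - PowerSeries.X) * m
      = PowerSeries.X ^ 2 * (d - 1)
        + (1 - PowerSeries.X) * PowerSeries.X * c * b * (d - 1)
        + (1 - PowerSeries.X) * PowerSeries.X * c * m * d ∧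
    F = c + c * m * d := by
  have hF := F_eq
  have hc := catS_eq (dvd_refl (PowerSeries.X : PowerSeries ℚ))
  have hd := catS_eq (v := ww) (Dvd.intro _ rfl)
  have hG := GG_eq
  have he := one_sub_mul_ee
  have hw : ww = PowerSeries.X * ee := rfl
  have hne : ww - PowerSeries.X ≠ 0 := by
    intro h
    have := congrArg (PowerSeries.coeff 2) h
    simp [ww, ee, PowerSeries.coeff_X, PowerSeries.coeff_succ_X_mul] at this
  generalize catS PowerSeries.X = c at *
  generalize catS ww = d at *
  generalize GG = G at *
  generalize ww = w at *
  generalize ee = e at *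
  generalize (PowerSeries.X : PowerSeries ℚ) = z at *
  have hww : (1 - z) * w = z := by rw [hw]; linear_combination z * he
  have hG1 : G * (1 - w * d - z * c) = 1 := by
    apply mul_left_cancel₀ hne
    linear_combination (1 - w * d - z * c) * hG + w * hd - z * hc
  refine ⟨c, d, z ^ 2 * c * e, w ^ 2 * d * z * c * G, hc, ?_, ?_, ?_, ?_⟩
  · linear_combination (1 - z) * hd + d ^ 2 * hww
  · linear_combination z ^ 2 * hc + (z ^ 2 * c - z ^ 3 * c ^ 2) * he
  · have h3 : d * (1 - w * d - z * c) = 1 - z * c * d := by linear_combination hd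
    have h4 : (1 - z) * (w ^ 2 * d * z * c * G) * (1 - z * c * d) = z ^ 2 * c * (d - 1) := by
      rw [← h3]
      linear_combination ((1 - z) * w ^ 2 * d ^ 2 * z * c) * hG1 + (w * d ^ 2 * z * c) * hww
        - z ^ 2 * c * hd
    linear_combination h4 - z ^ 3 * c ^ 2 * (d - 1) * he + z ^ 2 * (d - 1) * hc
  · have h5 : c * (1 - z * c) = 1 := by linear_combination hc
    have h6 : d * (1 - w * d) = 1 := by linear_combination hd
    have h7 : G - c * d = c * d * G * (w * d * (z * c)) := by
      linear_combination (-G) * h5 - G * c * (1 - z * c) * h6 + c * d * hG1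
    rw [hF]
    linear_combination w * h7
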